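/- arXiv:2212.14420 — 2 statements merged into one kernel-verified Lean document; each statement's English description precedes it below -/
import Mathlib

section
/- Let (S, f) and (T, g) be lifted partial permutations on k letters with T = f(S). Then for every i ∈ {1, …, m}, w_i(S, g∘f) ≤ w_i(S, f) + w_i(T, g). -/
open scoped Classical BigOperators

noncomputable section

/-- The group `G_m` of bijections of `ℤ` generated by the reflections
`x ↦ 1 - x` (about `1/2`) and `x ↦ 2m - 1 - x` (about `m - 1/2`). -/
def Gm (m : ℕ) : Subgroup (Equiv.Perm ℤ) :=
  Subgroup.closure {Equiv.subLeft (1 : ℤ), Equiv.subLeft (2 * (m : ℤ) - 1)}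

/-- `y` lies in the `G_m`-orbit of `x`. -/
def GmRel (m : ℕ) (x y : ℤ) : Prop := ∃ g ∈ Gm m, g x = y

/-- The `G_m`-orbit of an integer. -/
def GmOrbit (m : ℕ) (x : ℤ) : Set ℤ := {y | GmRel m x y}

/-- `(S, f)` is a lifted partial permutation on `k` letters: `S` is a
`G_m`-invariant subset of `ℤ`, `f` is `G_m`-equivariant on `S`, the quotient
`S/G_m` has exactly `k` elements, and the induced map `S/G_m → ℤ/G_m` is
injective.  (The values of `f` off `S` are irrelevant.) -/
structure IsLPP (m k : ℕ) (S : Set ℤ) (f : ℤ → ℤ) : Prop where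
  invariant : ∀ g ∈ Gm m, ∀ x ∈ S, g x ∈ S
  equivariant : ∀ g ∈ Gm m, ∀ x ∈ S, f (g x) = g (f x)
  orbits : (GmOrbit m '' S).ncard = k
  inj : ∀ x ∈ S, ∀ y ∈ S, GmRel m (f x) (f y) → GmRel m x y

/-- `(i, j)` is a crossing pair for `(S, f)`. -/
def IsCrossing (S : Set ℤ) (f : ℤ → ℤ) (i j : ℤ) : Prop :=
  i ∈ S ∧ j ∈ S ∧ i < j ∧ f j < f i

/-- The `G_m`-orbit of the unordered pair `{p.1, p.2}`; two pairs are
equivalent exactly when they have the same `pairOrbit`. -/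
def pairOrbit (m : ℕ) (p : ℤ × ℤ) : Set (Set ℤ) :=
  {A | ∃ g ∈ Gm m, A = {g p.1, g p.2}}

/-- The set of crossings of `(S, f)` (equivalence classes of crossing pairs). -/
def crossings (m : ℕ) (S : Set ℤ) (f : ℤ → ℤ) : Set (Set (Set ℤ)) :=
  pairOrbit m '' {p : ℤ × ℤ | IsCrossing S f p.1 p.2}

/-- The number of crossings `cross(f)`. -/
def crossCount (m : ℕ) (S : Set ℤ) (f : ℤ → ℤ) : ℕ := (crossings m S f).ncard

/-- The set whose cardinality (halved) is the weight `w_j(S, f)`. -/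
def weightSet (j : ℤ) (S : Set ℤ) (f : ℤ → ℤ) : Set ℤ :=
  {i | i ∈ S ∧ (((i : ℚ) < (j : ℚ) - 1/2 ∧ (j : ℚ) - 1/2 < (f i : ℚ)) ∨
    ((f i : ℚ) < (j : ℚ) - 1/2 ∧ (j : ℚ) - 1/2 < (i : ℚ)))}

/-- The weight `w_j(S, f)`. -/
def weight (j : ℤ) (S : Set ℤ) (f : ℤ → ℤ) : ℚ := (weightSet j S f).ncard / 2

/-- The resolution `f_{⟨i,j⟩}` of `f` at the crossing `⟨i, j⟩`. -/
def resolveFun (m : ℕ) (f : ℤ → ℤ) (i j : ℤ) : ℤ → ℤ := fun x =>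
  if h : ∃ g ∈ Gm m, g i = x then h.choose (f j)
  else if h' : ∃ g ∈ Gm m, g j = x then h'.choose (f i)
  else f x

/-- The graph `Γ_f = {(i, f i) : i ∈ S}`. -/
def graphOf (S : Set ℤ) (f : ℤ → ℤ) : Set (ℤ × ℤ) :=
  {p | p.1 ∈ S ∧ p.2 = f p.1}

/-- The `G_m`-orbit of a point of `ℤ × ℤ` under the diagonal action. -/
def GmOrbit2 (m : ℕ) (p : ℤ × ℤ) : Set (ℤ × ℤ) :=
  {q | ∃ g ∈ Gm m, (g p.1, g p.2) = q}

/-- The left endpoint of the image of the unit interval `[a, a+1]` under the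
affine extension of `g` to `ℝ`. -/
def sqIdx (g : Equiv.Perm ℤ) (a : ℤ) : ℤ := min (g a) (g (a + 1))

/-- The `G_m`-orbit of it the unit square indexed by `p`. -/
def sqOrbit (m : ℕ) (p : ℤ × ℤ) : Set (ℤ × ℤ) :=
  {q | ∃ g ∈ Gm m, (sqIdx g p.1, sqIdx g p.2) = q}

/-- `D` is a domain from `(S, f)` to `(T, g)`: a `G_m`-invariant assignment of
multiplicities to unit squares, nonzero on finitely many `G_m`-orbits of
squares, whose corners are governed by the two graphs. -/
def IsHDomain (m : ℕ) (S : Set ℤ) (f : ℤ → ℤ) (T : Set ℤ) (g : ℤ → ℤ)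
    (D : ℤ × ℤ → ℤ) : Prop :=
  (∀ γ ∈ Gm m, ∀ a b : ℤ, D (sqIdx γ a, sqIdx γ b) = D (a, b)) ∧
  (sqOrbit m '' {p : ℤ × ℤ | D p ≠ 0}).Finite ∧
  (∀ i j : ℤ,
    D (i, j) + D (i - 1, j - 1) - D (i, j - 1) - D (i - 1, j) =
      (if (i, j) ∈ graphOf T g then 1 else 0) -
        (if (i, j) ∈ graphOf S f then 1 else 0))


/-- Every element of `G_m` is a translation by a multiple of `2m - 2` or a reflection
`x ↦ c - x` with `c` odd. -/
theorem exists_eq_of_mem_Gm {m : ℕ} {γ : Equiv.Perm ℤ} (hγ : γ ∈ Gm m) :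
    ∃ n : ℤ, (∀ x, γ x = x + n * (2 * m - 2)) ∨ (∀ x, γ x = 1 - x + n * (2 * m - 2)) := by
  induction hγ using Subgroup.closure_induction with
  | mem γ hγ =>
    rcases hγ with rfl | rfl
    · exact ⟨0, Or.inr fun x => by simp⟩
    · exact ⟨1, Or.inr fun x => by simp only [Equiv.subLeft_apply]; ring⟩
  | one => exact ⟨0, Or.inl fun x => by simp⟩
  | mul a b _ _ ha hb =>
    obtain ⟨p, hp | hp⟩ := ha <;> obtain ⟨q, hq | hq⟩ := hb
    · exact ⟨p + q, Or.inl fun x => by rw [Equiv.Perm.mul_apply, hq, hp]; ring⟩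
    · exact ⟨p + q, Or.inr fun x => by rw [Equiv.Perm.mul_apply, hq, hp]; ring⟩
    · exact ⟨p - q, Or.inr fun x => by rw [Equiv.Perm.mul_apply, hq, hp]; ring⟩
    · exact ⟨p - q, Or.inl fun x => by rw [Equiv.Perm.mul_apply, hq, hp]; ring⟩
  | inv a _ ha =>
    obtain ⟨p, hp | hp⟩ := ha
    · exact ⟨-p, Or.inl fun x => by rw [Equiv.Perm.inv_eq_iff_eq, hp]; ring⟩
    · exact ⟨p, Or.inr fun x => by rw [Equiv.Perm.inv_eq_iff_eq, hp]; ring⟩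

/-- `G_m` acts freely on `ℤ`. -/
theorem apply_eq_self_of_mem_Gm {m : ℕ} {γ : Equiv.Perm ℤ} (hγ : γ ∈ Gm m) {x : ℤ}
    (hx : γ x = x) (y : ℤ) : γ y = y := by
  obtain ⟨n, h | h⟩ := exists_eq_of_mem_Gm hγ
  · rw [h] at hx ⊢
    linarith
  · rw [h, show n * (2 * (m : ℤ) - 2) = 2 * (n * (m - 1)) by ring] at hx
    omega

/-- `G_m` contains the translations by multiples of `2m - 2`. -/
theorem addRight_mem_Gm (m : ℕ) (n : ℤ) : Equiv.addRight (n * (2 * (m : ℤ) - 2)) ∈ Gm m := by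
  have h : Equiv.addRight (2 * (m : ℤ) - 2) ∈ Gm m := by
    have h' : Equiv.addRight (2 * (m : ℤ) - 2) =
        Equiv.subLeft (2 * (m : ℤ) - 1) * Equiv.subLeft (1 : ℤ) := by
      ext x
      simp only [Equiv.Perm.mul_apply, Equiv.subLeft_apply, Equiv.coe_addRight]
      ring
    rw [h']
    exact mul_mem (Subgroup.subset_closure (by simp)) (Subgroup.subset_closure (by simp))
  have hpow : Equiv.addRight (n * (2 * (m : ℤ) - 2)) = Equiv.addRight (2 * (m : ℤ) - 2) ^ n := by
    induction n with
    | zero => ext; simp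
    | succ n ih =>
      rw [zpow_add_one, ← ih]
      ext x
      simp only [Equiv.Perm.mul_apply, Equiv.coe_addRight]
      ring
    | pred n ih =>
      rw [zpow_sub_one, ← ih, eq_mul_inv_iff_mul_eq]
      ext x
      simp only [Equiv.Perm.mul_apply, Equiv.coe_addRight]
      ring
  exact hpow ▸ zpow_mem h n

/-- A lifted partial permutation is injective. -/
theorem IsLPP.injOn {m k : ℕ} {S : Set ℤ} {f : ℤ → ℤ} (hf : IsLPP m k S f) :
    Set.InjOn f S := by
  intro x hx y hy hxy
  obtain ⟨γ, hγ, rfl⟩ := hf.inj x hx y hy ⟨1, one_mem _, hxy⟩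
  rw [hf.equivariant γ hγ x hx] at hxy
  exact (apply_eq_self_of_mem_Gm hγ hxy.symm x).symm

/-- A lifted partial permutation has bounded displacement. -/
theorem IsLPP.exists_abs_sub_le {m k : ℕ} (hm : 2 ≤ m) {S : Set ℤ} {f : ℤ → ℤ}
    (hf : IsLPP m k S f) : ∃ B : ℤ, ∀ x ∈ S, |f x - x| ≤ B := by
  set P : ℤ := 2 * m - 2
  have hP : 0 < P := by omega
  refine ⟨∑ r ∈ Finset.Ico 0 P, |f r - r|, fun x hx => ?_⟩
  have hγ := addRight_mem_Gm m (-(x / P))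
  have hmod : Equiv.addRight (-(x / P) * P) x = x % P := by
    rw [Equiv.coe_addRight, Int.emod_def]
    ring
  have he := hf.equivariant _ hγ x hx
  rw [hmod, Equiv.coe_addRight] at he
  have hd : f x - x = f (x % P) - x % P := by
    rw [he, ← hmod, Equiv.coe_addRight]
    ring
  rw [hd]
  exact Finset.single_le_sum (f := fun r => |f r - r|) (fun _ _ => abs_nonneg _)
    (Finset.mem_Ico.2 ⟨Int.emod_nonneg _ hP.ne', Int.emod_lt_of_pos _ hP⟩)

theorem mem_weightSet_iff {j : ℤ} {S : Set ℤ} {f : ℤ → ℤ} {i : ℤ} :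
    i ∈ weightSet j S f ↔ i ∈ S ∧ ((i < j ∧ j ≤ f i) ∨ (f i < j ∧ j ≤ i)) := by
  have hlt (a : ℤ) : (a : ℚ) < (j : ℚ) - 1 / 2 ↔ a < j := by
    constructor <;> intro h
    · exact_mod_cast h.trans (by linarith : (j : ℚ) - 1 / 2 < j)
    · have : (a : ℚ) + 1 ≤ j := by exact_mod_cast h
      linarith
  have hgt (a : ℤ) : (j : ℚ) - 1 / 2 < (a : ℚ) ↔ j ≤ a := by
    constructor <;> intro h
    · by_contra! hlt
      have : (a : ℚ) + 1 ≤ j := by exact_mod_cast hlt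
      linarith
    · have : (j : ℚ) ≤ a := by exact_mod_cast h
      linarith
  simp only [weightSet, Set.mem_ofPred_eq, hlt, hgt]

theorem IsLPP.finite_weightSet {m k : ℕ} (hm : 2 ≤ m) {S : Set ℤ} {f : ℤ → ℤ}
    (hf : IsLPP m k S f) (j : ℤ) : (weightSet j S f).Finite := by
  obtain ⟨B, hB⟩ := hf.exists_abs_sub_le hm
  refine (Set.finite_Icc (j - B) (j + B)).subset fun i hi => ?_
  obtain ⟨hiS, h⟩ := mem_weightSet_iff.1 hi
  have := abs_le.1 (hB i hiS)
  constructor <;> omega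

/-- Weights are subadditive under composition:
`w_i(S, g∘f) ≤ w_i(S, f) + w_i(T, g)` for `i ∈ {1, …, m}`. -/
theorem weight_comp_le (m k : ℕ) (hm : 2 ≤ m) (hk0 : 0 < k) (hkm : k < m)
    (S : Set ℤ) (f : ℤ → ℤ) (T : Set ℤ) (g : ℤ → ℤ)
    (hf : IsLPP m k S f) (hg : IsLPP m k T g) (hT : T = f '' S) :
    ∀ i : ℤ, 1 ≤ i → i ≤ (m : ℤ) →
      weight i S (g ∘ f) ≤ weight i S f + weight i T g := by
  intro j _ _
  subst hT
  have hsub : weightSet j S (g ∘ f) ⊆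
      weightSet j S f ∪ {i ∈ S | f i ∈ weightSet j (f '' S) g} := by
    intro i hi
    simp only [Set.mem_union, Set.mem_ofPred_eq, mem_weightSet_iff, Function.comp_apply] at hi ⊢
    have := Set.mem_image_of_mem f hi.1
    grind
  have hmaps : Set.MapsTo f {i ∈ S | f i ∈ weightSet j (f '' S) g} (weightSet j (f '' S) g) :=
    fun _ hi => hi.2
  have hinj : Set.InjOn f {i ∈ S | f i ∈ weightSet j (f '' S) g} :=
    hf.injOn.mono fun _ hi => hi.1
  have hfin := hg.finite_weightSet hm j
  have hcard : (weightSet j S (g ∘ f)).ncard ≤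
      (weightSet j S f).ncard + (weightSet j (f '' S) g).ncard :=
    calc (weightSet j S (g ∘ f)).ncard
        ≤ (weightSet j S f ∪ {i ∈ S | f i ∈ weightSet j (f '' S) g}).ncard :=
          Set.ncard_le_ncard hsub
            ((hf.finite_weightSet hm j).union (Set.Finite.of_injOn hmaps hinj hfin))
      _ ≤ (weightSet j S f).ncard + {i ∈ S | f i ∈ weightSet j (f '' S) g}.ncard :=
          Set.ncard_union_le _ _
      _ ≤ _ := Nat.add_le_add_left (Set.ncard_le_ncard_of_injOn f hmaps hinj hfin) _
  have hcast : ((weightSet j S (g ∘ f)).ncard : ℚ) ≤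
      (weightSet j S f).ncard + (weightSet j (f '' S) g).ncard := by exact_mod_cast hcard
  simp only [weight]
  linarith
end
end

section
/- Let (S, f) be a lifted partial permutation on k letters and ⟨i, j⟩ a crossing of (S, f) with cross(f_{⟨i,j⟩}) = cross(f) − 1. Then for every l ∈ {1, …, m}, the difference w_l(S, f) − w_l(S, f_{⟨i,j⟩}) is a non-negative integer. -/
open scoped Classical BigOperators

noncomputable section

/-- The integers `a` and `b` lie on opposite sides of `l - 1/2`. -/
def Separates (l a b : ℤ) : Prop := (a < l ∧ l ≤ b) ∨ (b < l ∧ l ≤ a)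

/-- The elements of `G_m` that move `a` and `b` to opposite sides of `l - 1/2`. -/
def separators (m : ℕ) (l a b : ℤ) : Set (Equiv.Perm ℤ) :=
  {g | g ∈ Gm m ∧ Separates l (g a) (g b)}

/-- The elements of `G_m` that move both `a` and `b` to one side of `l - 1/2` and both `c` and `d`
to the other side. -/
def pairSeparators (m : ℕ) (l a b c d : ℤ) : Set (Equiv.Perm ℤ) :=
  {g | g ∈ Gm m ∧ ((g a < l ∧ g b < l ∧ l ≤ g c ∧ l ≤ g d) ∨
    (g c < l ∧ g d < l ∧ l ≤ g a ∧ l ≤ g b))}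

theorem mem_weightSet {l : ℤ} {S : Set ℤ} {f : ℤ → ℤ} {x : ℤ} :
    x ∈ weightSet l S f ↔ x ∈ S ∧ Separates l x (f x) := by
  have lt_iff (y : ℤ) : (y : ℚ) < (l : ℚ) - 1 / 2 ↔ y < l := by
    constructor
    · intro h
      have : (y : ℚ) < l := by linarith
      exact_mod_cast this
    · intro h
      have : (y : ℚ) + 1 ≤ l := by exact_mod_cast h
      linarith
  have gt_iff (y : ℤ) : (l : ℚ) - 1 / 2 < (y : ℚ) ↔ l ≤ y := by
    constructor
    · intro h
      have : (l : ℚ) < y + 1 := by linarith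
      exact Int.lt_add_one_iff.mp (by exact_mod_cast this)
    · intro h
      have : (l : ℚ) ≤ y := by exact_mod_cast h
      linarith
  simp only [weightSet, Set.mem_ofPred_eq, Separates, lt_iff, gt_iff]

theorem Gm_apply_eq {m : ℕ} {g : Equiv.Perm ℤ} (hg : g ∈ Gm m) :
    (∃ t : ℤ, ∀ x, g x = x + 2 * t) ∨ (∃ t : ℤ, ∀ x, g x = 2 * t + 1 - x) := by
  induction hg using Subgroup.closure_induction with
  | mem g hg =>
    rcases hg with rfl | rfl
    · exact .inr ⟨0, fun x => by simp⟩
    · exact .inr ⟨m - 1, fun x => by simp only [Equiv.subLeft_apply]; ring⟩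
  | one => exact .inl ⟨0, fun x => by simp⟩
  | mul g h _ _ hg hh =>
    rcases hg with ⟨s, hs⟩ | ⟨s, hs⟩ <;> rcases hh with ⟨t, ht⟩ | ⟨t, ht⟩
    · exact .inl ⟨s + t, fun x => by rw [Equiv.Perm.mul_apply, hs, ht]; ring⟩
    · exact .inr ⟨s + t, fun x => by rw [Equiv.Perm.mul_apply, hs, ht]; ring⟩
    · exact .inr ⟨s - t, fun x => by rw [Equiv.Perm.mul_apply, hs, ht]; ring⟩
    · exact .inl ⟨s - t, fun x => by rw [Equiv.Perm.mul_apply, hs, ht]; ring⟩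
  | inv g _ hg =>
    rcases hg with ⟨s, hs⟩ | ⟨s, hs⟩
    · exact .inl ⟨-s, fun x => by rw [Equiv.Perm.inv_eq_iff_eq, hs]; ring⟩
    · exact .inr ⟨s, fun x => by rw [Equiv.Perm.inv_eq_iff_eq, hs]; ring⟩

/-- The action of `G_m` on `ℤ` is free. -/
theorem Gm_injOn_apply (m : ℕ) (a : ℤ) :
    Set.InjOn (fun g : Equiv.Perm ℤ => g a) (Gm m : Set (Equiv.Perm ℤ)) := by
  intro g hg h hh hgh
  ext x
  dsimp only at hgh
  rcases Gm_apply_eq hg with ⟨s, hs⟩ | ⟨s, hs⟩ <;>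
    rcases Gm_apply_eq hh with ⟨t, ht⟩ | ⟨t, ht⟩ <;>
    rw [hs, ht] at hgh ⊢ <;> omega

theorem separators_finite (m : ℕ) (l a b : ℤ) : (separators m l a b).Finite := by
  refine Set.Finite.of_finite_image (f := fun g : Equiv.Perm ℤ => g a)
    ((Set.finite_Icc (l - |a - b|) (l + |a - b|)).subset ?_)
    ((Gm_injOn_apply m a).mono fun g hg => hg.1)
  rintro _ ⟨g, ⟨hg, hs⟩, rfl⟩
  have h₁ := le_abs_self (a - b)
  have h₂ := neg_abs_le (a - b)
  simp only [Set.mem_Icc]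
  unfold Separates at hs
  rcases Gm_apply_eq hg with ⟨t, ht⟩ | ⟨t, ht⟩ <;> rw [ht, ht] at hs <;> rw [ht] <;> omega

theorem ncard_eq_sum_indicator {α : Type*} {s : Set α} {U : Finset α} (h : s ⊆ U) :
    s.ncard = ∑ u ∈ U, if u ∈ s then 1 else 0 := by
  rw [← Finset.card_filter, ← Set.ncard_coe_finset]
  congr 1
  ext x
  simpa using fun hx => h hx

theorem ncard_separators_add {a b c d : ℤ} (m : ℕ) (l : ℤ) (hab : a < b) (hcd : d < c) :
    (separators m l a c).ncard + (separators m l b d).ncard =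
      (separators m l a d).ncard + (separators m l b c).ncard +
        2 * (pairSeparators m l a d b c).ncard := by
  have hf := (((separators_finite m l a c).union (separators_finite m l b d)).union
    (separators_finite m l a d)).union (separators_finite m l b c)
  have hU := hf.coe_toFinset
  set U := hf.toFinset
  have hQ : pairSeparators m l a d b c ⊆ separators m l a c := by
    rintro g ⟨hg, h⟩
    refine ⟨hg, ?_⟩
    unfold Separates
    omega
  have h₁ : separators m l a c ⊆ U := by
    rw [hU]; intro g hg; exact .inl (.inl (.inl hg))
  have h₂ : separators m l b d ⊆ U := by
    rw [hU]; intro g hg; exact .inl (.inl (.inr hg))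
  have h₃ : separators m l a d ⊆ U := by
    rw [hU]; intro g hg; exact .inl (.inr hg)
  have h₄ : separators m l b c ⊆ U := by
    rw [hU]; intro g hg; exact .inr hg
  rw [ncard_eq_sum_indicator h₁, ncard_eq_sum_indicator h₂, ncard_eq_sum_indicator h₃,
    ncard_eq_sum_indicator h₄, ncard_eq_sum_indicator (hQ.trans h₁), Finset.mul_sum,
    ← Finset.sum_add_distrib, ← Finset.sum_add_distrib, ← Finset.sum_add_distrib]
  refine Finset.sum_congr rfl fun g _ => ?_
  by_cases hg : g ∈ Gm m
  · simp only [separators, pairSeparators, Separates, Set.mem_ofPred_eq, hg, true_and]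
    rcases Gm_apply_eq hg with ⟨t, ht⟩ | ⟨t, ht⟩ <;> simp only [ht] <;> split_ifs <;> omega
  · simp [separators, pairSeparators, hg]

theorem ncard_separators_apply {m : ℕ} {r : Equiv.Perm ℤ} (hr : r ∈ Gm m) (l a b : ℤ) :
    (separators m l (r a) (r b)).ncard = (separators m l a b).ncard := by
  have : separators m l a b = (· * r) '' separators m l (r a) (r b) := by
    ext g
    constructor
    · rintro ⟨hg, h⟩
      exact ⟨g * r⁻¹, ⟨mul_mem hg (inv_mem hr), by simpa using h⟩, by simp⟩
    · rintro ⟨g, ⟨hg, h⟩, rfl⟩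
      exact ⟨mul_mem hg hr, h⟩
  rw [this, Set.ncard_image_of_injective _ (mul_left_injective r)]

theorem even_ncard_pairSeparators {m : ℕ} {r : Equiv.Perm ℤ} (hr : r ∈ Gm m) (hr1 : r ≠ 1)
    (hrr : r * r = 1) (l a b : ℤ) : Even (pairSeparators m l a b (r a) (r b)).ncard := by
  have hrr' (x : ℤ) : r (r x) = x := by rw [← Equiv.Perm.mul_apply, hrr, Equiv.Perm.one_apply]
  have hfin : (pairSeparators m l a b (r a) (r b)).Finite := by
    refine (separators_finite m l a (r a)).subset ?_
    rintro g ⟨hg, h⟩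
    refine ⟨hg, ?_⟩
    unfold Separates
    omega
  rw [Set.ncard_eq_toFinset_card _ hfin, ← ZMod.natCast_eq_zero_iff_even, Finset.cast_card]
  refine Finset.sum_involution (fun g _ => g * r) (fun _ _ => by decide)
    (fun g _ _ => by simpa using hr1) (fun g hg => ?_) (fun g _ => by rw [mul_assoc, hrr, mul_one])
  rw [Set.Finite.mem_toFinset] at hg ⊢
  refine ⟨mul_mem hg.1 hr, ?_⟩
  simp only [Equiv.Perm.mul_apply, hrr']
  exact hg.2.symm

theorem weightSet_inter_GmOrbit {m : ℕ} {S : Set ℤ} {F : ℤ → ℤ} {a b : ℤ}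
    (hS : ∀ g ∈ Gm m, g a ∈ S) (hF : ∀ g ∈ Gm m, F (g a) = g b) (l : ℤ) :
    weightSet l S F ∩ GmOrbit m a = (fun g : Equiv.Perm ℤ => g a) '' separators m l a b := by
  ext x
  constructor
  · rintro ⟨hx, g, hg, rfl⟩
    exact ⟨g, ⟨hg, by simpa [hF g hg] using (mem_weightSet.mp hx).2⟩, rfl⟩
  · rintro ⟨g, ⟨hg, h⟩, rfl⟩
    exact ⟨mem_weightSet.mpr ⟨hS g hg, by simpa [hF g hg] using h⟩, g, hg, rfl⟩

theorem ncard_weightSet_inter_GmOrbit {m : ℕ} {S : Set ℤ} {F : ℤ → ℤ} {a b : ℤ}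
    (hS : ∀ g ∈ Gm m, g a ∈ S) (hF : ∀ g ∈ Gm m, F (g a) = g b) (l : ℤ) :
    (weightSet l S F ∩ GmOrbit m a).ncard = (separators m l a b).ncard := by
  rw [weightSet_inter_GmOrbit hS hF,
    ((Gm_injOn_apply m a).mono fun g hg => hg.1).ncard_image]

theorem weightSet_inter_GmOrbit_finite {m : ℕ} {S : Set ℤ} {F : ℤ → ℤ} {a b : ℤ}
    (hS : ∀ g ∈ Gm m, g a ∈ S) (hF : ∀ g ∈ Gm m, F (g a) = g b) (l : ℤ) :
    (weightSet l S F ∩ GmOrbit m a).Finite := by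
  rw [weightSet_inter_GmOrbit hS hF]
  exact (separators_finite m l a b).image _

theorem IsLPP.weightSet_finite {m k : ℕ} {S : Set ℤ} {f : ℤ → ℤ} (h : IsLPP m k S f)
    (hk : 0 < k) (l : ℤ) : (weightSet l S f).Finite := by
  have hfin : (GmOrbit m '' S).Finite := Set.finite_of_ncard_pos (by rw [h.orbits]; exact hk)
  refine (hfin.biUnion (t := fun o => weightSet l S f ∩ o) ?_).subset ?_
  · rintro _ ⟨x, hx, rfl⟩
    exact weightSet_inter_GmOrbit_finite (fun g hg => h.invariant g hg x hx)
      (fun g hg => h.equivariant g hg x hx) l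
  · intro x hx
    exact Set.mem_biUnion (Set.mem_image_of_mem _ hx.1) ⟨hx, 1, one_mem _, rfl⟩

theorem disjoint_GmOrbit {m : ℕ} {a b : ℤ} (h : ¬ GmRel m a b) :
    Disjoint (GmOrbit m a) (GmOrbit m b) := by
  rw [Set.disjoint_left]
  rintro _ ⟨g, hg, rfl⟩ ⟨g', hg', h'⟩
  exact h ⟨g'⁻¹ * g, mul_mem (inv_mem hg') hg, by
    rw [Equiv.Perm.mul_apply, Equiv.Perm.inv_eq_iff_eq, h']⟩

theorem resolveFun_apply_left {m : ℕ} {f : ℤ → ℤ} {i j : ℤ} {g : Equiv.Perm ℤ} (hg : g ∈ Gm m) :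
    resolveFun m f i j (g i) = g (f j) := by
  have h : ∃ g' ∈ Gm m, g' i = g i := ⟨g, hg, rfl⟩
  rw [resolveFun, dif_pos h, Gm_injOn_apply m i h.choose_spec.1 hg h.choose_spec.2]

theorem resolveFun_apply_right {m : ℕ} {f : ℤ → ℤ} {i j : ℤ} (hij : ¬ GmRel m i j)
    {g : Equiv.Perm ℤ} (hg : g ∈ Gm m) : resolveFun m f i j (g j) = g (f i) := by
  have h : ∃ g' ∈ Gm m, g' j = g j := ⟨g, hg, rfl⟩
  have h' : ¬ ∃ g' ∈ Gm m, g' i = g j := fun hi =>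
    Set.disjoint_left.mp (disjoint_GmOrbit hij) hi h
  rw [resolveFun, dif_neg h', dif_pos h, Gm_injOn_apply m j h.choose_spec.1 hg h.choose_spec.2]

theorem resolveFun_apply_of_notMem {m : ℕ} {f : ℤ → ℤ} {i j x : ℤ} (hi : x ∉ GmOrbit m i)
    (hj : x ∉ GmOrbit m j) : resolveFun m f i j x = f x := by
  have hi' : ¬ ∃ g ∈ Gm m, g i = x := hi
  have hj' : ¬ ∃ g ∈ Gm m, g j = x := hj
  rw [resolveFun, dif_neg hi', dif_neg hj']

theorem weight_sub_weight_of_ncard_inter {l : ℤ} {S O : Set ℤ} {f F : ℤ → ℤ} {n : ℕ}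
    (hf : (weightSet l S f).Finite) (hF : (weightSet l S F ∩ O).Finite)
    (heq : ∀ x ∉ O, F x = f x)
    (hn : (weightSet l S f ∩ O).ncard = (weightSet l S F ∩ O).ncard + 2 * n) :
    weight l S f - weight l S F = n := by
  have hdiff : weightSet l S F \ O = weightSet l S f \ O := by
    ext x
    simp only [Set.mem_sdiff, mem_weightSet]
    exact and_congr_left fun hx => by rw [heq x hx]
  have hfin : (weightSet l S F).Finite := by
    rw [← Set.inter_union_sdiff (weightSet l S F) O, hdiff]
    exact hF.union hf.sdiff
  have h₁ := Set.ncard_inter_add_ncard_sdiff_eq_ncard (weightSet l S f) O hf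
  have h₂ := Set.ncard_inter_add_ncard_sdiff_eq_ncard (weightSet l S F) O hfin
  rw [hdiff] at h₂
  have h₃ : (weightSet l S f).ncard = (weightSet l S F).ncard + 2 * n := by omega
  rw [weight, weight, h₃]
  push_cast
  ring

theorem weight_sub_weight_resolveFun {m k : ℕ} (hk : 0 < k) {S : Set ℤ} {f : ℤ → ℤ}
    (h : IsLPP m k S f) {i j : ℤ} (hc : IsCrossing S f i j) (l : ℤ) :
    ∃ n : ℕ, weight l S f - weight l S (resolveFun m f i j) = (n : ℚ) := by
  obtain ⟨hi, hj, hij, hfij⟩ := hc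
  have hcount := ncard_separators_add m l hij hfij
  have hW := h.weightSet_finite hk l
  have hSi (g : Equiv.Perm ℤ) (hg : g ∈ Gm m) := h.invariant g hg i hi
  have hSj (g : Equiv.Perm ℤ) (hg : g ∈ Gm m) := h.invariant g hg j hj
  have hfi (g : Equiv.Perm ℤ) (hg : g ∈ Gm m) := h.equivariant g hg i hi
  have hfj (g : Equiv.Perm ℤ) (hg : g ∈ Gm m) := h.equivariant g hg j hj
  have hFi (g : Equiv.Perm ℤ) (hg : g ∈ Gm m) : resolveFun m f i j (g i) = g (f j) :=
    resolveFun_apply_left hg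
  have hBi := weightSet_inter_GmOrbit_finite hSi hFi l
  by_cases hrel : GmRel m i j
  · obtain ⟨r, hr, rfl⟩ := hrel
    rw [hfi r hr] at hfij
    obtain ⟨t, ht⟩ : ∃ t : ℤ, ∀ x, r x = 2 * t + 1 - x := by
      rcases Gm_apply_eq hr with ⟨t, ht⟩ | ht
      · rw [ht] at hij hfij
        omega
      · exact ht
    have hrr' (x : ℤ) : r (r x) = x := by rw [ht, ht]; ring
    have hr1 : r ≠ 1 := by
      rintro rfl
      exact lt_irrefl _ hij
    obtain ⟨n, hn⟩ := even_ncard_pairSeparators hr hr1 (Equiv.ext hrr') l i (f (r i))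
    have h₁ := ncard_separators_apply hr l i (f i)
    have h₂ := ncard_separators_apply hr l i (f (r i))
    rw [hfi r hr, hrr'] at hn h₂
    rw [hfi r hr] at hcount
    refine ⟨n, weight_sub_weight_of_ncard_inter (O := GmOrbit m i) hW hBi ?_ ?_⟩
    · intro x hx
      refine resolveFun_apply_of_notMem hx ?_
      rintro ⟨g, hg, rfl⟩
      exact hx ⟨g * r, mul_mem hg hr, rfl⟩
    · rw [ncard_weightSet_inter_GmOrbit hSi hfi, ncard_weightSet_inter_GmOrbit hSi hFi, hfi r hr]
      omega
  · have hFj (g : Equiv.Perm ℤ) (hg : g ∈ Gm m) : resolveFun m f i j (g j) = g (f i) :=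
      resolveFun_apply_right hrel hg
    have hBj := weightSet_inter_GmOrbit_finite hSj hFj l
    have hdisj (W : Set ℤ) : Disjoint (W ∩ GmOrbit m i) (W ∩ GmOrbit m j) :=
      (disjoint_GmOrbit hrel).mono Set.inter_subset_right Set.inter_subset_right
    refine ⟨_, weight_sub_weight_of_ncard_inter (O := GmOrbit m i ∪ GmOrbit m j) hW ?_ ?_ ?_
      (n := (pairSeparators m l i (f j) j (f i)).ncard)⟩
    · rw [Set.inter_union_distrib_left]
      exact hBi.union hBj
    · intro x hx
      exact resolveFun_apply_of_notMem (fun h => hx (.inl h)) (fun h => hx (.inr h))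
    · rw [Set.inter_union_distrib_left, Set.inter_union_distrib_left,
        Set.ncard_union_eq (hdisj _) (hW.inter_of_left _) (hW.inter_of_left _),
        Set.ncard_union_eq (hdisj _) hBi hBj,
        ncard_weightSet_inter_GmOrbit hSi hfi, ncard_weightSet_inter_GmOrbit hSi hFi,
        ncard_weightSet_inter_GmOrbit hSj hfj, ncard_weightSet_inter_GmOrbit hSj hFj]
      exact hcount

/-- If resolving the crossing `⟨i, j⟩` drops the crossing
number by exactly one, then for every `l ∈ {1, …, m}` the difference
`w_l(S, f) − w_l(S, f_{⟨i,j⟩})` is a non-negative integer. -/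
theorem weight_resolve_defect_integer (m k : ℕ) (hm : 2 ≤ m) (hk0 : 0 < k) (hkm : k < m)
    (S : Set ℤ) (f : ℤ → ℤ) (h : IsLPP m k S f)
    (i j : ℤ) (hc : IsCrossing S f i j)
    (hdrop : crossCount m S (resolveFun m f i j) + 1 = crossCount m S f) :
    ∀ l : ℤ, 1 ≤ l → l ≤ (m : ℤ) →
      ∃ n : ℕ, weight l S f - weight l S (resolveFun m f i j) = (n : ℚ) := by
  exact fun l _ _ => weight_sub_weight_resolveFun hk0 h hc l
end
end
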